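/- Let (Λ_Q, f) be a C^{1+Lip} expansive and transitive Markov system. Then there exist at most finitely many parabolic periodic points of f in Λ_Q. -/

import Mathlib

open Set Metric Filter MeasureTheory
open scoped Classical

/-- The word `[ω 0, ω 1, …, ω (n-1)]` read off from the sequence `ω`. -/
def wordOf {p : ℕ} (ω : ℕ → Fin p) (n : ℕ) : List (Fin p) :=
  (List.range n).map ω

/-- The cylinder sets `Δ_{i₁…iₙ} = g_{i₁…i_{n-1}}(I_{iₙ})` of the iterated function
system given by the big interval `I`, the subintervals `Isub i` and the maps `g i`;
by convention `Δ_∅ = I`. -/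
def cylOf {p : ℕ} (I : Set ℝ) (Isub : Fin p → Set ℝ) (g : Fin p → ℝ → ℝ) :
    List (Fin p) → Set ℝ
  | [] => I
  | [i] => Isub i
  | i :: j :: w => g i '' cylOf I Isub g (j :: w)

/-- The sequence `ω` contains the word `w` as a sub-word starting at position `n`. -/
def containsAt {p : ℕ} (ω : ℕ → Fin p) (w : List (Fin p)) (n : ℕ) : Prop :=
  ∀ k : ℕ, (hk : k < w.length) → ω (n + k) = w.get ⟨k, hk⟩

/-- The sequence `ω` belongs to `Σ_Q`, i.e. it contains no word of `Q` as a sub-word. -/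
def avoids {p : ℕ} (Q : Finset (List (Fin p))) (ω : ℕ → Fin p) : Prop :=
  ∀ w ∈ Q, ∀ n : ℕ, ¬ containsAt ω w n

/-- The limit set `Λ_Q = π(Σ_Q)`: points lying, for some `ω ∈ Σ_Q`, in all the
cylinders `Δ_{ω₀…ω_{n-1}}`. -/
def limitSetOf {p : ℕ} (I : Set ℝ) (Isub : Fin p → Set ℝ) (g : Fin p → ℝ → ℝ)
    (Q : Finset (List (Fin p))) : Set ℝ :=
  { x | ∃ ω : ℕ → Fin p, avoids Q ω ∧ ∀ n : ℕ, x ∈ cylOf I Isub g (wordOf ω n) }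

/-- `gIter g ω n = g_{i_n … i_1} = g_{ω (n-1)} ∘ ⋯ ∘ g_{ω 0}`. -/
def gIter {p : ℕ} (g : Fin p → ℝ → ℝ) (ω : ℕ → Fin p) : ℕ → ℝ → ℝ
  | 0 => id
  | n + 1 => g (ω n) ∘ gIter g ω n

/-- The derivative of the composition `gIter g ω n` at `x` (chain rule product). -/
noncomputable def gIterDer {p : ℕ} (g gder : Fin p → ℝ → ℝ) (ω : ℕ → Fin p)
    (n : ℕ) (x : ℝ) : ℝ :=
  ∏ k ∈ Finset.range n, gder (ω k) (gIter g ω k x)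

/-- Prepending the finite word `w` to the infinite sequence `ω`. -/
def prependWord {p : ℕ} (w : List (Fin p)) (ω : ℕ → Fin p) : ℕ → Fin p :=
  fun n => if h : n < w.length then w.get ⟨n, h⟩ else ω (n - w.length)

/-- `l(Σ_Q)`: the minimum, over all finite sets `Q'` of words with `Σ_{Q'} = Σ_Q`,
of the maximal length `l(Q')` of words of `Q'`. -/
noncomputable def minRepLen {p : ℕ} (Q : Finset (List (Fin p))) : ℕ :=
  sInf { n : ℕ | ∃ Q' : Finset (List (Fin p)),
    (∀ ω : ℕ → Fin p, avoids Q' ω ↔ avoids Q ω) ∧ Q'.sup List.length = n }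

/-- A `C^{1+Lip}` expansive and transitive Markov system `(Λ_Q, f)`. -/
structure ExpansiveMarkovSystem (p : ℕ) where
  /-- the alphabet is nonempty -/
  hp : 0 < p
  /-- the ambient closed interval `I` -/
  I : Set ℝ
  hI : ∃ a b : ℝ, a < b ∧ I = Set.Icc a b
  /-- the pairwise disjoint closed subintervals `I₁, …, I_p` -/
  Isub : Fin p → Set ℝ
  hIsub : ∀ i, ∃ a b : ℝ, a < b ∧ Isub i = Set.Icc a b
  hsubI : ∀ i, Isub i ⊆ I
  hdisj : ∀ i j, i ≠ j → Disjoint (Isub i) (Isub j)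
  /-- the contractions `g i`, defined on `⋃ j, Isub j` -/
  g : Fin p → ℝ → ℝ
  /-- the derivative of `g i` on `⋃ j, Isub j` -/
  gder : Fin p → ℝ → ℝ
  hg_inj : ∀ i, Set.InjOn (g i) (⋃ j, Isub j)
  hg_range : ∀ i, g i '' (⋃ j, Isub j) ⊆ interior (Isub i)
  hg_deriv : ∀ i, ∀ x ∈ ⋃ j, Isub j,
    HasDerivWithinAt (g i) (gder i x) (⋃ j, Isub j) x
  hgder_ne : ∀ i, ∀ x ∈ ⋃ j, Isub j, gder i x ≠ 0
  hgder_cont : ∀ i, ContinuousOn (gder i) (⋃ j, Isub j)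
  /-- `log |g i'|` is Lipschitz on the domain -/
  hgder_lip : ∀ i, ∃ θ : ℝ, ∀ x ∈ ⋃ j, Isub j, ∀ y ∈ ⋃ j, Isub j,
    abs (Real.log (abs (gder i x)) - Real.log (abs (gder i y))) ≤ θ * |x - y|
  /-- the expanding map `f`, with `f (g i x) = x` -/
  f : ℝ → ℝ
  /-- the derivative `f'` of `f` on the ranges of the `g i` -/
  fder : ℝ → ℝ
  hf : ∀ i, ∀ x ∈ ⋃ j, Isub j, f (g i x) = x
  hfder : ∀ i, ∀ x ∈ ⋃ j, Isub j, fder (g i x) = (gder i x)⁻¹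
  /-- the generator (expansivity) condition: `d_n → 0` -/
  hgen : ∀ ε : ℝ, 0 < ε → ∃ N : ℕ, ∀ w : List (Fin p), N ≤ w.length →
    Metric.diam (cylOf I Isub g w) < ε
  /-- the finite set of forbidden words -/
  Q : Finset (List (Fin p))
  /-- `Σ_Q` is completely invariant: `σ(Σ_Q) = Σ_Q` -/
  hQinv : ∀ ω : ℕ → Fin p, avoids Q ω →
    ∃ ω' : ℕ → Fin p, avoids Q ω' ∧ ∀ n : ℕ, ω' (n + 1) = ω n
  /-- `f|Λ_Q` is topologically transitive -/
  htrans : ∀ U V : Set ℝ, IsOpen U → IsOpen V →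
    (U ∩ limitSetOf I Isub g Q).Nonempty → (V ∩ limitSetOf I Isub g Q).Nonempty →
    ∃ n : ℕ, ∃ x ∈ U ∩ limitSetOf I Isub g Q, f^[n] x ∈ V

namespace ExpansiveMarkovSystem

variable {p : ℕ} (S : ExpansiveMarkovSystem p)

/-- The common domain `⋃ j, I_j` of the maps `g i`. -/
def dom : Set ℝ := ⋃ j, S.Isub j

/-- The cylinder `Δ_w` associated to the word `w`. -/
def cyl (w : List (Fin p)) : Set ℝ := cylOf S.I S.Isub S.g w

/-- The limit set `Λ_Q`. -/
def limitSet : Set ℝ := limitSetOf S.I S.Isub S.g S.Q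

/-- The domain of `f`, i.e. the union of the ranges of the `g i`. -/
def domF : Set ℝ := ⋃ i, S.g i '' S.dom

/-- The derivative `(fⁿ)'(x)` of the `n`-th iterate of `f` at `x`. -/
noncomputable def derIter (n : ℕ) (x : ℝ) : ℝ :=
  ∏ k ∈ Finset.range n, S.fder (S.f^[k] x)

/-- The Lyapunov exponent `χ(x) = limsup (1/n) log |(fⁿ)'(x)|`. -/
noncomputable def lyap (x : ℝ) : ℝ :=
  Filter.limsup (fun n : ℕ => Real.log |S.derIter n x| / n) Filter.atTop

/-- The set `H` of points of `Λ_Q` with infinitely many hyperbolic instants. -/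
def hypSet : Set ℝ :=
  { x ∈ S.limitSet | ∃ c₁ : ℝ, 0 < c₁ ∧ ∃ c₂ : ℝ, 0 < c₂ ∧
      ∃ n : ℕ → ℕ, StrictMono n ∧
        ∃ r : ℕ → ℝ, (∀ k, 0 < r k) ∧ Antitone r ∧
          Filter.Tendsto r Filter.atTop (nhds 0) ∧
          ∀ k : ℕ,
            (∀ y ∈ Metric.ball x (r k), ∀ j < n k, S.f^[j] y ∈ S.domF) ∧
            c₁ < Metric.diam (S.f^[n k] '' Metric.ball x (r k)) ∧
            (∀ y ∈ Metric.ball x (r k), ∀ z ∈ Metric.ball x (r k),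
              |S.derIter (n k) y| / |S.derIter (n k) z| < c₂) }

/-- `x` is a parabolic periodic point: `f^m(x) = x` and `|(f^m)'(x)| = 1`. -/
def IsParabolicPeriodic (x : ℝ) : Prop :=
  x ∈ S.limitSet ∧ ∃ m : ℕ, 1 ≤ m ∧ S.f^[m] x = x ∧ |S.derIter m x| = 1

/-- `ν` is a `t`-conformal (Borel probability) measure supported on `Λ_Q`. -/
def IsConformal (ν : Measure ℝ) (t : ℝ) : Prop :=
  IsProbabilityMeasure ν ∧ ν S.limitSetᶜ = 0 ∧
    ∀ A : Set ℝ, MeasurableSet A → A ⊆ S.limitSet → Set.InjOn S.f A →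
      ν (S.f '' A) = ∫⁻ x in A, ENNReal.ofReal (|S.fder x| ^ t) ∂ν

/-- `t_c = inf {t ≥ 0 : a t-conformal measure on Λ_Q exists}`. -/
noncomputable def tc : ℝ :=
  sInf { t : ℝ | 0 ≤ t ∧ ∃ ν : Measure ℝ, S.IsConformal ν t }

/-- `n` is a hyperbolic time for `x` with exponent `α`. -/
def IsHypTime (α : ℝ) (x : ℝ) (n : ℕ) : Prop :=
  ∀ k : ℕ, 1 ≤ k → k ≤ n → Real.exp (k * α) ≤ |S.derIter k (S.f^[n - k] x)|

/-- `H_HT(α)`: the points of `Λ_Q` with infinitely many hyperbolic times with exponent `α`. -/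
def HHT (α : ℝ) : Set ℝ :=
  { x ∈ S.limitSet | ∀ N : ℕ, ∃ n : ℕ, N ≤ n ∧ S.IsHypTime α x n }

end ExpansiveMarkovSystem

namespace ExpansiveMarkovSystem

variable {p : ℕ} (S : ExpansiveMarkovSystem p)

lemma Isub_subset_dom (i : Fin p) : S.Isub i ⊆ S.dom := subset_iUnion S.Isub i

lemma g_mem_Isub (i : Fin p) {x : ℝ} (hx : x ∈ S.dom) : S.g i x ∈ S.Isub i :=
  interior_subset (S.hg_range i (mem_image_of_mem _ hx))

lemma g_mem_dom (i : Fin p) {x : ℝ} (hx : x ∈ S.dom) : S.g i x ∈ S.dom :=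
  S.Isub_subset_dom i (S.g_mem_Isub i hx)

lemma f_g (i : Fin p) {x : ℝ} (hx : x ∈ S.dom) : S.f (S.g i x) = x := S.hf i x hx

lemma index_unique {i j : Fin p} {x : ℝ} (hi : x ∈ S.Isub i) (hj : x ∈ S.Isub j) : i = j := by
  by_contra h
  exact Set.disjoint_left.1 (S.hdisj i j h) hi hj

lemma cyl_cons_subset (w : List (Fin p)) (i : Fin p) : S.cyl (i :: w) ⊆ S.Isub i := by
  induction w generalizing i with
  | nil => exact subset_rfl
  | cons j w ih =>
    rintro _ ⟨y, hy, rfl⟩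
    exact S.g_mem_Isub i (S.Isub_subset_dom j (ih j hy))

lemma g_mem_cyl (i : Fin p) {w : List (Fin p)} (hw : w ≠ []) {x : ℝ} (hx : x ∈ S.cyl w) :
    S.g i x ∈ S.cyl (i :: w) := by
  cases w with
  | nil => exact absurd rfl hw
  | cons j w => exact mem_image_of_mem _ hx

lemma abs_sub_le_diam_cyl {w : List (Fin p)} (hw : w ≠ []) {x y : ℝ} (hx : x ∈ S.cyl w)
    (hy : y ∈ S.cyl w) : |x - y| ≤ Metric.diam (S.cyl w) := by
  cases w with
  | nil => exact absurd rfl hw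
  | cons i w =>
    obtain ⟨a, b, -, hab⟩ := S.hIsub i
    have hb : Bornology.IsBounded (S.cyl (i :: w)) :=
      (hab ▸ Metric.isBounded_Icc a b : Bornology.IsBounded (S.Isub i)).subset
        (S.cyl_cons_subset w i)
    simpa [Real.dist_eq] using Metric.dist_le_diam_of_mem hb hx hy

/-- The forward orbit of `x` stays in the domain of `f`. -/
def Survives (x : ℝ) : Prop := ∀ k : ℕ, S.f^[k] x ∈ S.domF

variable {S}

lemma Survives.iterate {x : ℝ} (hx : S.Survives x) (n : ℕ) : S.Survives (S.f^[n] x) := by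
  intro k
  rw [← Function.iterate_add_apply]
  exact hx _

lemma Survives.mem_dom {x : ℝ} (hx : S.Survives x) : x ∈ S.dom := by
  obtain ⟨i, y, hy, rfl⟩ := mem_iUnion.1 (hx 0)
  exact S.g_mem_dom i hy

lemma Survives.exists_eq_g {x : ℝ} (hx : S.Survives x) : ∃ i, x = S.g i (S.f x) := by
  obtain ⟨i, y, hy, h⟩ := mem_iUnion.1 (hx 0)
  rw [Function.iterate_zero_apply] at h
  exact ⟨i, by rw [← h, S.f_g i hy]⟩

lemma Survives.fder_ne_zero {x : ℝ} (hx : S.Survives x) : S.fder x ≠ 0 := by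
  obtain ⟨i, hi⟩ := hx.exists_eq_g
  have hd : S.f x ∈ S.dom := (hx.iterate 1).mem_dom
  rw [hi, S.hfder i _ hd]
  exact inv_ne_zero (S.hgder_ne i _ hd)

variable (S)

lemma survives_of_mem_limitSet {x : ℝ} (hx : x ∈ S.limitSet) : S.Survives x := by
  obtain ⟨ω, -, hω⟩ := hx
  suffices h : ∀ k, S.f^[k] x ∈ S.domF ∧
      ∀ n, S.f^[k] x ∈ S.cyl (wordOf (fun j => ω (j + k)) n) from fun k => (h k).1
  have aux : ∀ (ν : ℕ → Fin p) (z : ℝ), (∀ n, z ∈ S.cyl (wordOf ν n)) →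
      z ∈ S.domF ∧ ∀ n, S.f z ∈ S.cyl (wordOf (fun j => ν (j + 1)) n) := by
    intro ν z hz
    have hw : ∀ n, wordOf ν (n + 1) = ν 0 :: wordOf (fun j => ν (j + 1)) n := by
      intro n
      simp [wordOf, List.range_succ_eq_map, Function.comp_def]
    have hstep : ∀ n, z ∈ S.g (ν 0) '' S.cyl (wordOf (fun j => ν (j + 1)) (n + 1)) := by
      intro n
      have h := hz (n + 2)
      rw [hw (n + 1)] at h
      simpa [wordOf, List.range_succ_eq_map, cyl, cylOf] using h
    have hpos : ∀ n, S.f z ∈ S.cyl (wordOf (fun j => ν (j + 1)) (n + 1)) ∧ z ∈ S.domF := by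
      intro n
      obtain ⟨y, hy, hyz⟩ := hstep n
      have hyd : y ∈ S.dom := by
        have : wordOf (fun j => ν (j + 1)) (n + 1) = ν 1 :: wordOf (fun j => ν (j + 2)) n := by
          simp [wordOf, List.range_succ_eq_map, Function.comp_def]
        rw [this] at hy
        exact S.Isub_subset_dom _ (S.cyl_cons_subset _ _ hy)
      refine ⟨by rwa [← hyz, S.f_g _ hyd], mem_iUnion.2 ⟨ν 0, y, hyd, hyz⟩⟩
    refine ⟨(hpos 0).2, fun n => ?_⟩
    cases n with
    | zero => exact S.hsubI _ (S.cyl_cons_subset [] _ (hpos 0).1)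
    | succ n => exact (hpos n).1
  intro k
  induction k with
  | zero => exact ⟨(aux ω x hω).1, hω⟩
  | succ k ih =>
    have h := aux _ _ ih.2
    rw [Function.iterate_succ_apply']
    have e : (fun j => ω (j + 1 + k)) = fun j => ω (j + (k + 1)) := by
      funext j; congr 1; omega
    have h2 := h.2
    rw [e] at h2
    exact ⟨(aux _ _ h2).1, h2⟩

/-- Points with the same itinerary coincide. -/
lemma eq_of_same_itinerary {x y : ℝ} (hx : S.Survives x) (hy : S.Survives y)
    (h : ∀ k i, S.f^[k] x ∈ S.Isub i → S.f^[k] y ∈ S.Isub i) : x = y := by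
  have key : ∀ n : ℕ, ∀ x y : ℝ, S.Survives x → S.Survives y →
      (∀ k i, S.f^[k] x ∈ S.Isub i → S.f^[k] y ∈ S.Isub i) →
      ∃ w : List (Fin p), w.length = n + 1 ∧ x ∈ S.cyl w ∧ y ∈ S.cyl w := by
    intro n
    induction n with
    | zero =>
      intro x y hx _ h
      obtain ⟨i, hi⟩ := mem_iUnion.1 hx.mem_dom
      exact ⟨[i], rfl, hi, h 0 i hi⟩
    | succ n ih =>
      intro x y hx hy h
      obtain ⟨w, hw, hxw, hyw⟩ := ih (S.f x) (S.f y) (hx.iterate 1) (hy.iterate 1)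
        fun k i => by simpa only [← Function.iterate_succ_apply] using h (k + 1) i
      obtain ⟨i, hi⟩ := hx.exists_eq_g
      obtain ⟨j, hj⟩ := hy.exists_eq_g
      have hxi : x ∈ S.Isub i := hi ▸ S.g_mem_Isub i (hx.iterate 1).mem_dom
      have hyj : y ∈ S.Isub j := hj ▸ S.g_mem_Isub j (hy.iterate 1).mem_dom
      obtain rfl := S.index_unique (h 0 i hxi) hyj
      have hne : w ≠ [] := by rintro rfl; simp at hw
      refine ⟨i :: w, by simp [hw], ?_, ?_⟩
      · rw [hi]; exact S.g_mem_cyl i hne hxw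
      · rw [hj]; exact S.g_mem_cyl i hne hyw
  refine eq_of_forall_dist_le fun ε hε => ?_
  obtain ⟨N, hN⟩ := S.hgen ε hε
  obtain ⟨w, hw, hxw, hyw⟩ := key N x y hx hy h
  have hne : w ≠ [] := by rintro rfl; simp at hw
  exact (S.abs_sub_le_diam_cyl hne hxw hyw).trans (hN w (by omega)).le

lemma finite_survives_periodic {n : ℕ} (hn : 0 < n) :
    {x : ℝ | S.Survives x ∧ S.f^[n] x = x}.Finite := by
  let F : ℝ → Fin n → Set (Fin p) := fun x k => {i | S.f^[k] x ∈ S.Isub i}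
  refine Set.Finite.of_finite_image (f := F) (Set.toFinite _) ?_
  rintro x ⟨hx, hxn⟩ y ⟨hy, hyn⟩ hxy
  refine S.eq_of_same_itinerary hx hy fun k i hk => ?_
  have hx' : Function.IsPeriodicPt S.f n x := hxn
  have hy' : Function.IsPeriodicPt S.f n y := hyn
  rw [← hx'.iterate_mod_apply k] at hk
  rw [← hy'.iterate_mod_apply k]
  have := congrFun hxy ⟨k % n, Nat.mod_lt k hn⟩
  exact (Set.ext_iff.1 this i).1 hk

section InverseBranches

variable (ω : ℕ → Fin p)

lemma gIter_mem_dom (n : ℕ) {x : ℝ} (hx : x ∈ S.dom) : gIter S.g ω n x ∈ S.dom := by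
  induction n with
  | zero => exact hx
  | succ n ih => exact S.g_mem_dom _ ih

lemma f_iterate_gIter (k j : ℕ) {x : ℝ} (hx : x ∈ S.dom) :
    S.f^[k] (gIter S.g ω (k + j) x) = gIter S.g ω j x := by
  induction k with
  | zero => simp
  | succ k ih =>
    rw [Function.iterate_succ_apply, ← ih, Nat.add_right_comm k 1 j]
    exact congrArg _ (S.f_g _ (S.gIter_mem_dom ω _ hx))

lemma exists_gIter_mem_cyl (a : Fin p) (n : ℕ) : ∃ w : List (Fin p), w.length = n + 1 ∧
    ∀ x ∈ S.Isub a, gIter S.g ω n x ∈ S.cyl w := by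
  induction n with
  | zero => exact ⟨[a], rfl, fun x hx => hx⟩
  | succ n ih =>
    obtain ⟨w, hw, h⟩ := ih
    have hne : w ≠ [] := by rintro rfl; simp at hw
    exact ⟨ω n :: w, by simp [hw], fun x hx => S.g_mem_cyl _ hne (h x hx)⟩

lemma hasDerivWithinAt_gIter (n : ℕ) {x : ℝ} (hx : x ∈ S.dom) :
    HasDerivWithinAt (gIter S.g ω n) (gIterDer S.g S.gder ω n x) S.dom x := by
  induction n with
  | zero => simpa [gIter, gIterDer] using hasDerivWithinAt_id x S.dom
  | succ n ih =>
    have h := (S.hg_deriv (ω n) _ (S.gIter_mem_dom ω n hx)).comp x ih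
      fun y hy => S.gIter_mem_dom ω n hy
    rwa [mul_comm, show gIterDer S.g S.gder ω n x * S.gder (ω n) (gIter S.g ω n x) =
      gIterDer S.g S.gder ω (n + 1) x from (Finset.prod_range_succ _ _).symm] at h

lemma continuousOn_gIter (n : ℕ) : ContinuousOn (gIter S.g ω n) S.dom :=
  fun _ hx => (S.hasDerivWithinAt_gIter ω n hx).continuousWithinAt

lemma gIterDer_ne_zero (n : ℕ) {x : ℝ} (hx : x ∈ S.dom) : gIterDer S.g S.gder ω n x ≠ 0 :=
  Finset.prod_ne_zero_iff.2 fun k _ => S.hgder_ne _ _ (S.gIter_mem_dom ω k hx)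

lemma derIter_succ (n : ℕ) (x : ℝ) : S.derIter (n + 1) x = S.derIter n (S.f x) * S.fder x := by
  simp [derIter, Finset.prod_range_succ']

lemma derIter_gIter_mul (n : ℕ) {x : ℝ} (hx : x ∈ S.dom) :
    S.derIter n (gIter S.g ω n x) * gIterDer S.g S.gder ω n x = 1 := by
  induction n with
  | zero => simp [derIter, gIterDer]
  | succ n ih =>
    have hd := S.gIter_mem_dom ω n hx
    have h1 : S.f (gIter S.g ω (n + 1) x) = gIter S.g ω n x := S.f_g _ hd
    have h2 : S.fder (gIter S.g ω (n + 1) x) = (S.gder (ω n) (gIter S.g ω n x))⁻¹ :=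
      S.hfder _ _ hd
    have h3 : gIterDer S.g S.gder ω (n + 1) x =
        gIterDer S.g S.gder ω n x * S.gder (ω n) (gIter S.g ω n x) := Finset.prod_range_succ _ _
    rw [derIter_succ, h1, h2, h3, ← ih]
    field_simp [S.hgder_ne (ω n) _ hd]

lemma abs_log_gIterDer_sub_le {θ : ℝ}
    (hθ : ∀ i, ∀ x ∈ S.dom, ∀ y ∈ S.dom,
      |Real.log (|S.gder i x|) - Real.log (|S.gder i y|)| ≤ θ * |x - y|)
    (n : ℕ) {x y : ℝ} (hx : x ∈ S.dom) (hy : y ∈ S.dom) :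
    |Real.log (|gIterDer S.g S.gder ω n x|) - Real.log (|gIterDer S.g S.gder ω n y|)| ≤
      θ * ∑ k ∈ Finset.range n, |gIter S.g ω k x - gIter S.g ω k y| := by
  have hlog : ∀ z ∈ S.dom, Real.log |gIterDer S.g S.gder ω n z| =
      ∑ k ∈ Finset.range n, Real.log |S.gder (ω k) (gIter S.g ω k z)| := by
    intro z hz
    rw [gIterDer, Finset.abs_prod, Real.log_prod]
    exact fun k _ => abs_ne_zero.2 (S.hgder_ne _ _ (S.gIter_mem_dom ω k hz))
  rw [hlog x hx, hlog y hy, ← Finset.sum_sub_distrib, Finset.mul_sum]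
  exact (Finset.abs_sum_le_sum_abs _ _).trans (Finset.sum_le_sum fun k _ =>
    hθ _ _ (S.gIter_mem_dom ω k hx) _ (S.gIter_mem_dom ω k hy))

end InverseBranches

section PeriodBound

/-- If `z` is the rightmost point of its cycle, the pullbacks of an interval with left
endpoint `z` along the cycle are disjoint, so their total length is bounded. -/
lemma sum_abs_gIter_sub_le (ω : ℕ → Fin p) {m : ℕ} {z t A B : ℝ} (hzt : z ≤ t)
    (hdom : Icc z t ⊆ S.dom) (hAB : S.dom ⊆ Icc A B)
    (hT : ∀ j, gIter S.g ω j z ≤ z) (hf : ∀ j, S.f^[j] z ≤ z)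
    (hne : ∀ j, 0 < j → j < m → S.f^[j] z ≠ z) :
    ∑ k ∈ Finset.range m, |gIter S.g ω k t - gIter S.g ω k z| ≤ B - A := by
  have hz : z ∈ S.dom := hdom ⟨le_rfl, hzt⟩
  have hcont : ∀ k, ∀ s ∈ Icc z t, ContinuousOn (gIter S.g ω k) (uIcc z s) := fun k s hs =>
    (S.continuousOn_gIter ω k).mono <| by
      rw [uIcc_of_le hs.1]
      exact (Icc_subset_Icc_right hs.2).trans hdom
  let W : ℕ → Set ℝ := fun k => uIoo (gIter S.g ω k z) (gIter S.g ω k t)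
  have hW : ∀ k, ∀ y ∈ W k, ∃ s ∈ Ioc z t, y = gIter S.g ω k s := by
    intro k y hy
    obtain ⟨s, hs, rfl⟩ := intermediate_value_uIcc (hcont k t ⟨hzt, le_rfl⟩)
      (uIoo_subset_uIcc_self hy)
    rw [uIcc_of_le hzt] at hs
    refine ⟨s, ⟨lt_of_le_of_ne hs.1 ?_, hs.2⟩, rfl⟩
    rintro rfl
    exact left_notMem_uIoo hy
  have hdisj : ∀ k l, k < l → l < m → Disjoint (W k) (W l) := by
    intro k l hkl hlm
    refine Set.disjoint_left.2 fun y hyk hyl => ?_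
    obtain ⟨s, hs, rfl⟩ := hW k y hyk
    obtain ⟨s', hs', hss'⟩ := hW l _ hyl
    obtain ⟨j, rfl⟩ := Nat.exists_eq_add_of_lt hkl
    have hsj : s = gIter S.g ω (j + 1) s' := by
      have h1 := S.f_iterate_gIter ω k 0 (hdom ⟨hs.1.le, hs.2⟩)
      have h2 := S.f_iterate_gIter ω k (j + 1) (hdom ⟨hs'.1.le, hs'.2⟩)
      rw [add_assoc] at hss'
      rw [← h2, ← hss']
      exact h1.symm
    have hlt : gIter S.g ω (j + 1) z ≠ z := by
      intro h
      have h1 := S.f_iterate_gIter ω (j + 1) 0 hz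
      rw [add_zero, h] at h1
      exact hne (j + 1) (by omega) (by omega) h1
    have hmem : z ∈ uIcc (gIter S.g ω (j + 1) z) (gIter S.g ω (j + 1) s') :=
      Icc_subset_uIcc ⟨hT _, hsj ▸ hs.1.le⟩
    obtain ⟨r, hr, hrz⟩ := intermediate_value_uIcc (hcont (j + 1) s' ⟨hs'.1.le, hs'.2⟩) hmem
    rw [uIcc_of_le hs'.1.le] at hr
    have hzr : z < r := lt_of_le_of_ne hr.1 fun h => hlt (by rw [h, hrz, h])
    have h1 := S.f_iterate_gIter ω (j + 1) 0 (hdom ⟨hr.1, hr.2.trans hs'.2⟩)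
    rw [add_zero, hrz] at h1
    exact absurd (hf (j + 1)) (not_le.2 (h1 ▸ hzr))
  have hsub : (⋃ k ∈ Finset.range m, W k) ⊆ Icc A B := by
    refine iUnion₂_subset fun k _ y hy => ?_
    obtain ⟨s, hs, rfl⟩ := hW k y hy
    exact hAB (S.gIter_mem_dom ω k (hdom ⟨hs.1.le, hs.2⟩))
  have hvol : volume (⋃ k ∈ Finset.range m, W k) =
      ∑ k ∈ Finset.range m, ENNReal.ofReal |gIter S.g ω k t - gIter S.g ω k z| := by
    rw [measure_biUnion_finset]
    · exact Finset.sum_congr rfl fun k _ => Real.volume_uIoo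
    · intro k hk l hl hkl
      rw [Finset.mem_coe, Finset.mem_range] at hk hl
      rcases hkl.lt_or_gt with h | h
      · exact hdisj k l h hl
      · exact (hdisj l k h hk).symm
    · exact fun k _ => measurableSet_Ioo
  have hle := measure_mono (μ := volume) hsub
  rw [hvol, Real.volume_Icc, ← ENNReal.ofReal_sum_of_nonneg fun _ _ => abs_nonneg _] at hle
  have hABz := hAB hz
  exact (ENNReal.ofReal_le_ofReal_iff (by linarith [hABz.1, hABz.2])).1 hle

lemma exists_dom_subset_Icc : ∃ A B : ℝ, S.dom ⊆ Icc A B := by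
  obtain ⟨A, B, -, hI⟩ := S.hI
  exact ⟨A, B, hI ▸ iUnion_subset S.hsubI⟩

lemma exists_distortion_const : ∃ θ : ℝ, 0 ≤ θ ∧ ∀ i, ∀ x ∈ S.dom, ∀ y ∈ S.dom,
    |Real.log (|S.gder i x|) - Real.log (|S.gder i y|)| ≤ θ * |x - y| := by
  choose θ hθ using S.hgder_lip
  refine ⟨∑ i, |θ i|, Finset.sum_nonneg fun _ _ => abs_nonneg _, fun i x hx y hy => ?_⟩
  refine (hθ i x hx y hy).trans (mul_le_mul_of_nonneg_right ?_ (abs_nonneg _))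
  exact (le_abs_self _).trans
    (Finset.single_le_sum (f := fun i => |θ i|) (fun _ _ => abs_nonneg _) (Finset.mem_univ i))

lemma isCompact_dom : IsCompact S.dom :=
  isCompact_iUnion fun i => by
    obtain ⟨a, b, -, hab⟩ := S.hIsub i
    exact hab ▸ isCompact_Icc

/-- Points of `g a (dom)` have a definite distance to the right endpoint of `Isub a`. -/
lemma exists_gap (a : Fin p) : ∃ b δ : ℝ, 0 < δ ∧
    ∀ x ∈ S.g a '' S.dom, x + δ ≤ b ∧ Icc x b ⊆ S.Isub a := by
  obtain ⟨c, b, hcb, hI⟩ := S.hIsub a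
  have hcomp : IsCompact (S.g a '' S.dom) :=
    S.isCompact_dom.image_of_continuousOn fun x hx => (S.hg_deriv a x hx).continuousWithinAt
  have hne : (S.g a '' S.dom).Nonempty :=
    ⟨_, mem_image_of_mem _ (S.Isub_subset_dom a (hI ▸ left_mem_Icc.2 hcb.le))⟩
  obtain ⟨M, hM, hmax⟩ := hcomp.exists_isGreatest hne
  have hMI : ∀ x ∈ S.g a '' S.dom, x ∈ Ioo c b := fun x hx => by
    have := S.hg_range a hx
    rwa [hI, interior_Icc] at this
  refine ⟨b, b - M, by linarith [(hMI M hM).2], fun x hx => ⟨by linarith [hmax hx], ?_⟩⟩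
  rw [hI]
  exact Icc_subset_Icc_left (hMI x hx).1.le

variable {S} in
/-- Inverse branches along the cycle of a periodic point. -/
lemma Survives.exists_inverse_itinerary {z : ℝ} (hz : S.Survives z) {m : ℕ} (hm : 0 < m)
    (hper : S.f^[m] z = z) :
    ∃ ω : ℕ → Fin p, ∀ k, gIter S.g ω k z = S.f^[(m - 1) * k] z := by
  have hstep : ∀ k, S.f (S.f^[(m - 1) * (k + 1)] z) = S.f^[(m - 1) * k] z := by
    intro k
    rw [← Function.iterate_succ_apply' S.f,
      show ((m - 1) * (k + 1)).succ = (m - 1) * k + m by rw [Nat.mul_succ]; omega,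
      Function.iterate_add_apply, hper]
  choose ω hω using fun k => (hz.iterate ((m - 1) * (k + 1))).exists_eq_g
  refine ⟨ω, fun k => ?_⟩
  induction k with
  | zero => rfl
  | succ k ih =>
    rw [hω k, hstep k, ← ih]
    rfl

/-- The period of a weakly repelling cycle whose rightmost point lies in `g a (dom)` is bounded. -/
lemma exists_period_bound (a : Fin p) : ∃ N : ℕ, ∀ (z : ℝ) (m : ℕ), S.Survives z →
    z ∈ S.g a '' S.dom → 0 < m → S.f^[m] z = z → (∀ j, 0 < j → j < m → S.f^[j] z ≠ z) →
    (∀ j, S.f^[j] z ≤ z) → |S.derIter m z| = 1 → m < N := by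
  obtain ⟨A, B, hAB⟩ := S.exists_dom_subset_Icc
  obtain ⟨θ, hθ0, hθ⟩ := S.exists_distortion_const
  obtain ⟨b, δ, hδ, hgap⟩ := S.exists_gap a
  obtain ⟨N, hN⟩ := S.hgen (Real.exp (-(θ * (B - A))) * δ) (by positivity)
  refine ⟨N, fun z m hz hza hm hper hmin hmax hder => ?_⟩
  by_contra! hNm
  obtain ⟨hzδ, hzb⟩ := hgap z hza
  have hzb' : z < b := by linarith
  have hsub : Icc z b ⊆ S.dom := hzb.trans (S.Isub_subset_dom a)
  obtain ⟨ω, hω⟩ := hz.exists_inverse_itinerary hm hper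
  have hmz : gIter S.g ω m z = z := by
    rw [hω, mul_comm]
    exact (show Function.IsPeriodicPt S.f m z from hper).mul_const (m - 1)
  have hone : |gIterDer S.g S.gder ω m z| = 1 := by
    have h := congrArg abs (S.derIter_gIter_mul ω m hz.mem_dom)
    rwa [hmz, abs_mul, hder, one_mul, abs_one] at h
  obtain ⟨c, hc, hslope⟩ := exists_hasDerivAt_eq_slope (gIter S.g ω m)
    (gIterDer S.g S.gder ω m) hzb' ((S.continuousOn_gIter ω m).mono hsub) fun x hx =>
      (S.hasDerivWithinAt_gIter ω m (hsub (Ioo_subset_Icc_self hx))).hasDerivAt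
        (mem_of_superset (Icc_mem_nhds hx.1 hx.2) hsub)
  have hcd : c ∈ S.dom := hsub (Ioo_subset_Icc_self hc)
  have hsum := S.sum_abs_gIter_sub_le ω (m := m) hc.1.le
    ((Icc_subset_Icc_right hc.2.le).trans hsub) hAB (fun j => hω j ▸ hmax _) hmax hmin
  have hdist := (S.abs_log_gIterDer_sub_le ω hθ m hcd hz.mem_dom).trans
    (mul_le_mul_of_nonneg_left hsum hθ0)
  rw [hone, Real.log_one, sub_zero] at hdist
  have hlow : Real.exp (-(θ * (B - A))) ≤ |gIterDer S.g S.gder ω m c| := by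
    rw [← Real.le_log_iff_exp_le (abs_pos.2 (S.gIterDer_ne_zero ω m hcd))]
    exact (abs_le.1 hdist).1
  obtain ⟨w, hw, hwc⟩ := S.exists_gIter_mem_cyl ω a m
  have hne : w ≠ [] := by rintro rfl; simp at hw
  have hdiam := S.abs_sub_le_diam_cyl hne (hwc b (hzb (right_mem_Icc.2 hzb'.le)))
    (hwc z (hzb (left_mem_Icc.2 hzb'.le)))
  rw [eq_div_iff (by linarith)] at hslope
  rw [← hslope, abs_mul, abs_of_pos (sub_pos.2 hzb')] at hdiam
  have hlt : Metric.diam (S.cyl w) < _ := hN w (by omega)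
  have : Real.exp (-(θ * (B - A))) * δ ≤ |gIterDer S.g S.gder ω m c| * (b - z) :=
    mul_le_mul hlow (by linarith) hδ.le (abs_nonneg _)
  linarith

end PeriodBound

section Cycles

variable {S}

lemma Survives.derIter_iterate {x : ℝ} (hx : S.Survives x) {m : ℕ} (hper : S.f^[m] x = x)
    (j : ℕ) : S.derIter m (S.f^[j] x) = S.derIter m x := by
  induction j with
  | zero => rfl
  | succ j ih =>
    rw [← ih, Function.iterate_succ_apply']
    refine mul_right_cancel₀ (hx.iterate j).fder_ne_zero ?_
    rw [← derIter_succ, derIter, Finset.prod_range_succ, ← Function.iterate_add_apply, add_comm,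
      Function.iterate_add_apply, hper, derIter]

lemma derIter_mul_period {x : ℝ} {m : ℕ} (hper : S.f^[m] x = x) (q : ℕ) :
    S.derIter (m * q) x = S.derIter m x ^ q := by
  induction q with
  | zero => simp [derIter]
  | succ q ih =>
    have hq : S.f^[m * q] x = x := (show Function.IsPeriodicPt S.f m x from hper).mul_const q
    rw [pow_succ, ← ih, Nat.mul_succ, derIter, Finset.prod_range_add]
    simp only [add_comm (m * q), Function.iterate_add_apply, hq, derIter]

/-- A parabolic cycle has a rightmost point, to which the period bound applies. -/
lemma IsParabolicPeriodic.exists_rightmost {x : ℝ} (hx : S.IsParabolicPeriodic x) :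
    ∃ (a : Fin p) (z : ℝ), S.Survives z ∧ z ∈ S.g a '' S.dom ∧
      0 < Function.minimalPeriod S.f x ∧ S.f^[Function.minimalPeriod S.f x] z = z ∧
      (∀ j, 0 < j → j < Function.minimalPeriod S.f x → S.f^[j] z ≠ z) ∧
      (∀ j, S.f^[j] z ≤ z) ∧ |S.derIter (Function.minimalPeriod S.f x) z| = 1 := by
  obtain ⟨hxΛ, n, hn, hper, hder⟩ := hx
  have hsx := S.survives_of_mem_limitSet hxΛ
  have hpt : Function.IsPeriodicPt S.f n x := hper
  have hpp : x ∈ Function.periodicPts S.f := Function.mk_mem_periodicPts hn hpt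
  set m := Function.minimalPeriod S.f x with hm
  have hm0 : 0 < m := Function.minimalPeriod_pos_of_mem_periodicPts hpp
  have hmx : S.f^[m] x = x := Function.iterate_minimalPeriod
  obtain ⟨i, -, hi⟩ := (Finset.range m).exists_max_image (fun k => S.f^[k] x)
    ⟨0, Finset.mem_range.2 hm0⟩
  have hmz : Function.minimalPeriod S.f (S.f^[i] x) = m :=
    Function.minimalPeriod_apply_iterate hpp i
  obtain ⟨a, ha⟩ := mem_iUnion.1 (hsx i)
  refine ⟨a, S.f^[i] x, hsx.iterate i, ha, hm0, ?_, fun j hj0 hjm h => ?_, fun j => ?_, ?_⟩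
  · rw [← hmz]
    exact Function.iterate_minimalPeriod
  · exact Function.not_isPeriodicPt_of_pos_of_lt_minimalPeriod hj0.ne' (hmz ▸ hjm) h
  · rw [← Function.iterate_add_apply, ← Function.iterate_mod_minimalPeriod_eq]
    exact hi _ (Finset.mem_range.2 (Nat.mod_lt _ hm0))
  · rw [hsx.derIter_iterate hmx]
    obtain ⟨q, rfl⟩ := hpt.minimalPeriod_dvd
    rw [derIter_mul_period hmx, abs_pow] at hder
    exact (pow_eq_one_iff_of_nonneg (abs_nonneg _) (by rintro rfl; simp at hn)).1 hder

end Cycles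

end ExpansiveMarkovSystem

/-- There exist at most finitely many parabolic periodic points of `f`
in `Λ_Q`. -/
theorem parabolic_periodic_finite {p : ℕ} (S : ExpansiveMarkovSystem p) :
    { x : ℝ | S.IsParabolicPeriodic x }.Finite := by
  choose N hN using S.exists_period_bound
  refine (S.finite_survives_periodic (∑ a, N a).factorial_pos).subset fun x hx => ?_
  obtain ⟨a, z, hz, hza, hm0, hper, hmin, hmax, hder⟩ := hx.exists_rightmost
  have hlt := hN a z _ hz hza hm0 hper hmin hmax hder
  have hle : N a ≤ ∑ a, N a := Finset.single_le_sum (fun _ _ => Nat.zero_le _) (Finset.mem_univ a)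
  exact ⟨S.survives_of_mem_limitSet hx.1,
    Function.isPeriodicPt_iff_minimalPeriod_dvd.2 (Nat.dvd_factorial hm0 (hlt.le.trans hle))⟩
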